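/- For every real μ ≥ 0, the spectrum of the matrix F(μ) (as an element of the algebra of 2×2 complex matrices) consists of exactly the two distinct points ζ(μ) and −ζ(μ), where ζ(μ) = e^{iπ/4}/√(2·cosh(πμ)); in particular det(z·I − F(μ)) = z² − i/(2·cosh(πμ)) for all z ∈ ℂ. -/

import Mathlib

open MeasureTheory Set

/-- `F₊₋(μ) = (2π)^{-1/2} e^{iπ/4} e^{-πμ/2} Γ(1/2 + iμ)`. -/
noncomputable def Fpm (μ : ℝ) : ℂ :=
  (Real.sqrt (2 * Real.pi) : ℂ)⁻¹ * Complex.exp (Complex.I * Real.pi / 4) *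
    Complex.exp (-(Real.pi * μ) / 2) * Complex.Gamma (1/2 + Complex.I * μ)

/-- `F₋₊(μ) = (2π)^{-1/2} e^{iπ/4} e^{πμ/2} Γ(1/2 - iμ)`. -/
noncomputable def Fmp (μ : ℝ) : ℂ :=
  (Real.sqrt (2 * Real.pi) : ℂ)⁻¹ * Complex.exp (Complex.I * Real.pi / 4) *
    Complex.exp ((Real.pi * μ) / 2) * Complex.Gamma (1/2 - Complex.I * μ)

/-- The matrix `F(μ) = !![0, F₊₋(μ); F₋₊(μ), 0]`. -/
noncomputable def Fmat (μ : ℝ) : Matrix (Fin 2) (Fin 2) ℂ := !![0, Fpm μ; Fmp μ, 0]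

/-- `ζ(μ) = e^{iπ/4}/√(2 cosh(πμ))`. -/
noncomputable def zeta (μ : ℝ) : ℂ :=
  Complex.exp (Complex.I * Real.pi / 4) / (Real.sqrt (2 * Real.cosh (Real.pi * μ)) : ℂ)

theorem expI_sq_aux : Complex.exp (Complex.I * Real.pi / 4) ^ 2 = Complex.I := by
  rw [← Complex.exp_nat_mul]
  have h : ((2 : ℕ) : ℂ) * (Complex.I * Real.pi / 4) = ((Real.pi / 2 : ℝ) : ℂ) * Complex.I := by
    push_cast; ring
  rw [h, Complex.exp_mul_I, ← Complex.ofReal_cos, ← Complex.ofReal_sin]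
  simp

theorem Fprod_aux (μ : ℝ) : Fpm μ * Fmp μ = Complex.I / (2 * Real.cosh (Real.pi * μ)) := by
  have hG : Complex.Gamma (1/2 + Complex.I * μ) * Complex.Gamma (1/2 - Complex.I * μ)
      = Real.pi / Real.cosh (Real.pi * μ) := by
    have h := Complex.Gamma_mul_Gamma_one_sub (1/2 + Complex.I * μ)
    have e : (1 : ℂ) - (1/2 + Complex.I * μ) = 1/2 - Complex.I * μ := by ring
    have e2 : (Real.pi : ℂ) * (1/2 + Complex.I * μ)
        = ((Real.pi * μ : ℝ) : ℂ) * Complex.I + Real.pi / 2 := by push_cast; ring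
    rw [e, e2, Complex.sin_add_pi_div_two, Complex.cos_mul_I, ← Complex.ofReal_cosh] at h
    exact h
  have hE : Complex.exp (-(Real.pi * μ) / 2) * Complex.exp ((Real.pi * μ) / 2) = 1 := by
    rw [← Complex.exp_add, ← Complex.exp_zero]; congr 1; ring
  have hS : (Real.sqrt (2 * Real.pi) : ℂ) ^ 2 = 2 * Real.pi := by
    rw [← Complex.ofReal_pow, Real.sq_sqrt (by positivity)]; push_cast; ring
  have hpi : (Real.pi : ℂ) ≠ 0 := by exact_mod_cast Real.pi_ne_zero
  have hc : (Real.cosh (Real.pi * μ) : ℂ) ≠ 0 := by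
    exact_mod_cast (Real.cosh_pos _).ne'
  calc Fpm μ * Fmp μ = ((Real.sqrt (2 * Real.pi) : ℂ) ^ 2)⁻¹ *
        Complex.exp (Complex.I * Real.pi / 4) ^ 2 *
        (Complex.exp (-(Real.pi * μ) / 2) * Complex.exp ((Real.pi * μ) / 2)) *
        (Complex.Gamma (1/2 + Complex.I * μ) * Complex.Gamma (1/2 - Complex.I * μ)) := by
          unfold Fpm Fmp; rw [← inv_pow]; ring
    _ = _ := by
      rw [hG, hE, hS, expI_sq_aux]; field_simp

theorem zeta_sq_aux (μ : ℝ) : zeta μ ^ 2 = Complex.I / (2 * Real.cosh (Real.pi * μ)) := by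
  have := Real.cosh_pos (Real.pi * μ)
  unfold zeta
  rw [div_pow, expI_sq_aux, ← Complex.ofReal_pow, Real.sq_sqrt (by positivity)]
  push_cast; rfl

theorem Fmat_spectrum (μ : ℝ) (hμ : 0 ≤ μ) :
    spectrum ℂ (Fmat μ) = {zeta μ, -zeta μ} ∧
    zeta μ ≠ -zeta μ ∧
    ∀ z : ℂ, (z • (1 : Matrix (Fin 2) (Fin 2) ℂ) - Fmat μ).det
      = z ^ 2 - Complex.I / (2 * Real.cosh (Real.pi * μ)) := by
  have hdet : ∀ z : ℂ, (z • (1 : Matrix (Fin 2) (Fin 2) ℂ) - Fmat μ).det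
      = z ^ 2 - Complex.I / (2 * Real.cosh (Real.pi * μ)) := by
    intro z
    rw [← Fprod_aux, Matrix.det_fin_two]
    simp [Fmat]
    ring
  refine ⟨?_, ?_, hdet⟩
  · ext z
    rw [spectrum.mem_iff, Algebra.algebraMap_eq_smul_one, Matrix.isUnit_iff_isUnit_det, hdet,
      isUnit_iff_ne_zero, not_not, ← zeta_sq_aux, sub_eq_zero, sq_eq_sq_iff_eq_or_eq_neg]
    rfl
  · intro h
    have h0 : zeta μ = 0 := self_eq_neg.mp h
    have h1 := zeta_sq_aux μ
    have hc : (Real.cosh (Real.pi * μ) : ℂ) ≠ 0 := by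
      exact_mod_cast (Real.cosh_pos _).ne'
    rw [h0] at h1
    have : Complex.I / (2 * Real.cosh (Real.pi * μ)) ≠ 0 :=
      div_ne_zero Complex.I_ne_zero (mul_ne_zero two_ne_zero hc)
    exact this (by rw [← h1]; simp)
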